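/- arXiv:1309.5884 — 2 statements merged into one kernel-verified Lean document; each statement's English description precedes it below -/
import Mathlib

section
/- Let (X,d) be an Hadamard space and f : X → ℝ ∪ {+∞} proper, convex and lower semicontinuous. Then the proximal mapping of f is nonexpansive: d(Prox_f(x₁), Prox_f(x₂)) ≤ d(x₁, x₂) for all x₁, x₂ ∈ X. -/
open Set

/-- Reshetnyak's quadrilateral inequality, from the comparison inequality for geodesics. -/
theorem quadrilateral_inequality {X : Type*} [MetricSpace X] (G : X → X → ℝ → X)
    (hcmp : ∀ x y z : X, ∀ l ∈ Icc (0:ℝ) 1,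
      dist z (G x y l) ^ 2 ≤ (1 - l) * dist z x ^ 2 + l * dist z y ^ 2
        - l * (1 - l) * dist x y ^ 2)
    {a b c e : X} (hab : 0 < dist a b) (hce : 0 < dist c e) :
    dist a c ^ 2 + dist b e ^ 2
      ≤ dist b c ^ 2 + dist a e ^ 2 + 2 * (dist a b * dist c e) := by
  have hs : 0 < dist a b + dist c e := add_pos hab hce
  obtain ⟨t, ht⟩ : ∃ t, t = dist a b / (dist a b + dist c e) := ⟨_, rfl⟩
  have hst : t * (dist a b + dist c e) = dist a b := by rw [ht]; field_simp
  have ht0 : 0 < t := by rw [ht]; positivity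
  have ht1 : 0 < 1 - t := by
    have : 1 - t = dist c e / (dist a b + dist c e) := by rw [ht]; field_simp; ring
    rw [this]; positivity
  have h1 := hcmp b e a t ⟨ht0.le, by linarith⟩
  have h2 := hcmp b e c t ⟨ht0.le, by linarith⟩
  have h3 := dist_triangle_right a c (G b e t)
  rw [dist_comm c b] at h2
  have h4 : t * (1 - t) * dist a c ^ 2
      ≤ (1 - t) * dist a (G b e t) ^ 2 + t * dist c (G b e t) ^ 2 := by
    have h5 : t * (1 - t) * dist a c ^ 2
        ≤ t * (1 - t) * (dist a (G b e t) + dist c (G b e t)) ^ 2 := by gcongr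
    nlinarith [sq_nonneg ((1 - t) * dist a (G b e t) - t * dist c (G b e t))]
  have h6 : (1 - t) ^ 2 * dist a b ^ 2 + t ^ 2 * dist c e ^ 2
      = t * (1 - t) * (2 * (dist a b * dist c e)) := by
    have : (1 - t) * dist a b - t * dist c e = 0 := by linarith
    linear_combination ((1 - t) * dist a b - t * dist c e) * this
  have h7 := mul_le_mul_of_nonneg_left h1 ht1.le
  have h8 := mul_le_mul_of_nonneg_left h2 ht0.le
  refine le_of_mul_le_mul_left ?_ (mul_pos ht0 ht1)
  linarith

/-- The variational inequality satisfied by a proximal point `p` of `x`, at points `q` of the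
domain of `f`. -/
theorem prox_variational_inequality {X : Type*} [MetricSpace X] (G : X → X → ℝ → X)
    (hcmp : ∀ x y z : X, ∀ l ∈ Icc (0:ℝ) 1,
      dist z (G x y l) ^ 2 ≤ (1 - l) * dist z x ^ 2 + l * dist z y ^ 2
        - l * (1 - l) * dist x y ^ 2)
    (f : X → EReal)
    (hconv : ∀ x y : X, ∀ l ∈ Icc (0:ℝ) 1,
      f (G x y l) ≤ ((1 - l : ℝ) : EReal) * f x + ((l : ℝ) : EReal) * f y)
    {x p q : X}
    (hp : ∀ z : X, f p + (((1/2) * dist x p ^ 2 : ℝ) : EReal)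
      ≤ f z + (((1/2) * dist x z ^ 2 : ℝ) : EReal))
    {u v : ℝ} (hu : f p = u) (hv : f q = v) :
    u + 1 / 2 * dist x p ^ 2 + 1 / 2 * dist p q ^ 2 ≤ v + 1 / 2 * dist x q ^ 2 := by
  have key : ∀ l : ℝ, 0 < l → l ≤ 1 →
      u + 1 / 2 * dist x p ^ 2 + (1 - l) * (1 / 2 * dist p q ^ 2)
        ≤ v + 1 / 2 * dist x q ^ 2 := by
    intro l hl0 hl1
    have h1 := (hp (G p q l)).trans (add_le_add_left (hconv p q l ⟨hl0.le, hl1⟩) _)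
    rw [hu, hv] at h1
    have h2 : u + 1 / 2 * dist x p ^ 2
        ≤ (1 - l) * u + l * v + 1 / 2 * dist x (G p q l) ^ 2 := by exact_mod_cast h1
    have h3 := hcmp p q x l ⟨hl0.le, hl1⟩
    refine le_of_mul_le_mul_left ?_ hl0
    linarith
  by_contra! hlt
  obtain ⟨ε, hε⟩ : ∃ ε, ε = u + 1 / 2 * dist x p ^ 2 + 1 / 2 * dist p q ^ 2
    - (v + 1 / 2 * dist x q ^ 2) := ⟨_, rfl⟩
  have hε0 : 0 < ε := by linarith
  obtain ⟨B, hB⟩ : ∃ B, B = 1 / 2 * dist p q ^ 2 := ⟨_, rfl⟩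
  have hB0 : 0 ≤ B := by rw [hB]; positivity
  have hl : 0 < ε / (B + ε) := by positivity
  have h := key (ε / (B + ε)) hl ((div_le_one (by positivity)).2 (by linarith))
  have h' : ε / (B + ε) * (B + ε) = ε := div_mul_cancel₀ _ (by positivity)
  rw [← hB] at h hε
  nlinarith [mul_pos hl hε0]

/-- A proximal point of a proper function lies in its domain. -/
theorem exists_real_eq_of_prox {X : Type*} [MetricSpace X] (f : X → EReal)
    (hproper : ∃ x, f x ≠ ⊤) (hbot : ∀ x, f x ≠ ⊥) {x p : X}
    (hp : ∀ z : X, f p + (((1/2) * dist x p ^ 2 : ℝ) : EReal)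
      ≤ f z + (((1/2) * dist x z ^ 2 : ℝ) : EReal)) :
    ∃ u : ℝ, f p = u := by
  obtain ⟨z, hz⟩ := hproper
  refine ⟨(f p).toReal, (EReal.coe_toReal (fun htop => ?_) (hbot p)).symm⟩
  have h := hp z
  rw [htop, EReal.top_add_coe, top_le_iff] at h
  exact EReal.add_ne_top hz (EReal.coe_ne_top _) h

/-- In an Hadamard space, the proximal mapping `prox` of a proper, convex,
lower semicontinuous function `f : X → ℝ ∪ {+∞}` (where `prox x` minimizes
`z ↦ f z + (1/2) d(x,z)²`) is nonexpansive: `d(prox x₁, prox x₂) ≤ d(x₁, x₂)`. -/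
theorem prox_nonexpansive {X : Type*} [MetricSpace X] [CompleteSpace X]
    (G : X → X → ℝ → X)
    (hG0 : ∀ x y, G x y 0 = x) (hG1 : ∀ x y, G x y 1 = y)
    (hGd : ∀ x y, ∀ s ∈ Icc (0:ℝ) 1, ∀ t ∈ Icc (0:ℝ) 1,
      dist (G x y s) (G x y t) = |s - t| * dist x y)
    (hcmp : ∀ x y z : X, ∀ l ∈ Icc (0:ℝ) 1,
      dist z (G x y l) ^ 2 ≤ (1 - l) * dist z x ^ 2 + l * dist z y ^ 2
        - l * (1 - l) * dist x y ^ 2)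
    (f : X → EReal)
    (hproper : ∃ x, f x ≠ ⊤) (hbot : ∀ x, f x ≠ ⊥)
    (hconv : ∀ x y : X, ∀ l ∈ Icc (0:ℝ) 1,
      f (G x y l) ≤ ((1 - l : ℝ) : EReal) * f x + ((l : ℝ) : EReal) * f y)
    (hlsc : LowerSemicontinuous f)
    (prox : X → X)
    (hprox : ∀ x z : X, f (prox x) + (((1/2) * dist x (prox x) ^ 2 : ℝ) : EReal)
      ≤ f z + (((1/2) * dist x z ^ 2 : ℝ) : EReal))
    (x₁ x₂ : X) :
    dist (prox x₁) (prox x₂) ≤ dist x₁ x₂ := by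
  obtain ⟨u, hu⟩ := exists_real_eq_of_prox f hproper hbot (hprox x₁)
  obtain ⟨v, hv⟩ := exists_real_eq_of_prox f hproper hbot (hprox x₂)
  have h1 := prox_variational_inequality G hcmp f hconv (hprox x₁) hu hv
  have h2 := prox_variational_inequality G hcmp f hconv (hprox x₂) hv hu
  rw [dist_comm (prox x₂) (prox x₁)] at h2
  rcases eq_or_ne x₁ x₂ with rfl | hx
  · simp
  rcases eq_or_ne (prox x₁) (prox x₂) with hpq | hpq
  · simp [hpq]
  have hD := dist_pos.2 hpq
  have h3 := quadrilateral_inequality G hcmp (dist_pos.2 hx) (dist_pos.2 hpq.symm)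
  rw [dist_comm (prox x₂) (prox x₁)] at h3
  refine le_of_mul_le_mul_right ?_ hD
  linarith
end

section
/- Let (x_n) be a bounded sequence in an Hadamard space X and let C ⊆ X. Suppose that for every c ∈ C the real sequence (d(x_n, c)) converges, and that every weak cluster point of (x_n) belongs to C. Then x_n ⇀ c for some c ∈ C. -/
open Set Filter Topology

/-- Weak convergence in a geodesic metric space with geodesic map `G`: `u ⇀ x` iff for
every `y`, the metric projections of `u n` onto the geodesic segment `[x,y]`
(i.e. any choice of nearest points on `G x y '' [0,1]`) converge to `x`. -/
def WeakConv {X : Type*} [MetricSpace X] (G : X → X → ℝ → X) (u : ℕ → X) (x : X) : Prop :=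
  ∀ y : X, ∀ p : ℕ → X,
    (∀ n, p n ∈ G x y '' Icc (0:ℝ) 1 ∧
      ∀ q ∈ G x y '' Icc (0:ℝ) 1, dist (u n) (p n) ≤ dist (u n) q) →
    Tendsto p atTop (nhds x)

/-- A weak cluster point of a sequence: a point to which some subsequence weakly
converges. -/
def WeakClusterPt {X : Type*} [MetricSpace X] (G : X → X → ℝ → X)
    (u : ℕ → X) (x : X) : Prop :=
  ∃ φ : ℕ → ℕ, StrictMono φ ∧ WeakConv G (u ∘ φ) x

/-- The asymptotic radius of `u` along the filter `F`: the infimum of the radii of the balls that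
eventually contain `u`. -/
noncomputable def asymptoticRadius {X ι : Type*} [MetricSpace X] (u : ι → X) (F : Filter ι) : ℝ :=
  sInf {r | ∃ x, ∀ᶠ n in F, dist (u n) x ≤ r}

/-- `c` is an asymptotic center of `u` along `F`. -/
def IsAsymptoticCenter {X ι : Type*} [MetricSpace X] (u : ι → X) (F : Filter ι) (c : X) : Prop :=
  ∀ s, asymptoticRadius u F < s → ∀ᶠ n in F, dist (u n) c ≤ s

section AsymptoticRadius

variable {X ι : Type*} [MetricSpace X] {u : ι → X}

lemma asymptoticRadius_le {F : Filter ι} [F.NeBot] {r : ℝ} {x : X}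
    (h : ∀ᶠ n in F, dist (u n) x ≤ r) : asymptoticRadius u F ≤ r := by
  refine csInf_le ⟨0, ?_⟩ ⟨x, h⟩
  rintro s ⟨y, hy⟩
  obtain ⟨n, hn⟩ := hy.exists
  exact dist_nonneg.trans hn

lemma asymptoticRadius_set_nonempty (hu : Bornology.IsBounded (range u)) (hX : Nonempty X)
    (F : Filter ι) : {r | ∃ x, ∀ᶠ n in F, dist (u n) x ≤ r}.Nonempty := by
  obtain ⟨x⟩ := hX
  obtain ⟨R, hR⟩ := (Metric.isBounded_iff_subset_closedBall x).1 hu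
  exact ⟨R, x, Eventually.of_forall fun n => hR (mem_range_self n)⟩

lemma asymptoticRadius_nonneg {F : Filter ι} [F.NeBot] : 0 ≤ asymptoticRadius u F := by
  refine Real.sInf_nonneg ?_
  rintro s ⟨y, hy⟩
  obtain ⟨n, hn⟩ := hy.exists
  exact dist_nonneg.trans hn

lemma asymptoticRadius_mono (hu : Bornology.IsBounded (range u)) (hX : Nonempty X)
    {F F' : Filter ι} [F'.NeBot] (h : F' ≤ F) : asymptoticRadius u F' ≤ asymptoticRadius u F := by
  refine le_csInf (asymptoticRadius_set_nonempty hu hX F) ?_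
  rintro r ⟨x, hx⟩
  exact asymptoticRadius_le (hx.filter_mono h)

lemma exists_eventually_dist_le (hu : Bornology.IsBounded (range u)) (hX : Nonempty X)
    {F : Filter ι} {s : ℝ} (hs : asymptoticRadius u F < s) :
    ∃ x, ∀ᶠ n in F, dist (u n) x ≤ s := by
  obtain ⟨r, ⟨x, hx⟩, hr⟩ := exists_lt_of_csInf_lt (asymptoticRadius_set_nonempty hu hX F) hs
  exact ⟨x, hx.mono fun n hn => hn.trans hr.le⟩

lemma asymptoticRadius_sq_le {F : Filter ι} [F.NeBot] {a : ℝ} {x : X}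
    (h : ∀ᶠ n in F, dist (u n) x ^ 2 ≤ a) : asymptoticRadius u F ^ 2 ≤ a := by
  have ha : 0 ≤ a := by
    obtain ⟨n, hn⟩ := h.exists
    exact (sq_nonneg _).trans hn
  have : asymptoticRadius u F ≤ √a :=
    asymptoticRadius_le (x := x) (h.mono fun n hn => Real.le_sqrt_of_sq_le hn)
  calc _ ≤ √a ^ 2 := pow_le_pow_left₀ asymptoticRadius_nonneg this 2
    _ = a := Real.sq_sqrt ha

/-- A point whose squared distance to `u` is eventually smaller than that of a center by a fixed
amount contradicts the definition of the asymptotic radius. -/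
lemma IsAsymptoticCenter.not_eventually_sq_dist_le {F F' : Filter ι} [F'.NeBot] {c z : X}
    (hc : IsAsymptoticCenter u F c) (hF : F' ≤ F)
    (hr : asymptoticRadius u F ≤ asymptoticRadius u F') {ε : ℝ} (hε : 0 < ε) :
    ¬ ∀ᶠ n in F', dist (u n) z ^ 2 ≤ dist (u n) c ^ 2 - ε := by
  intro h
  have hcont : Tendsto (fun s : ℝ => s ^ 2 - ε) (𝓝[>] asymptoticRadius u F)
      (𝓝 (asymptoticRadius u F ^ 2 - ε)) := by
    have : Continuous fun s : ℝ => s ^ 2 - ε := by fun_prop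
    exact (this.tendsto _).mono_left nhdsWithin_le_nhds
  have key : asymptoticRadius u F' ^ 2 ≤ asymptoticRadius u F ^ 2 - ε := by
    refine ge_of_tendsto hcont ?_
    filter_upwards [self_mem_nhdsWithin] with s hs
    refine asymptoticRadius_sq_le (x := z) ?_
    filter_upwards [h, (hc s hs).filter_mono hF] with n h1 h2
    have := pow_le_pow_left₀ dist_nonneg h2 2
    linarith
  have h0 : 0 ≤ asymptoticRadius u F := by
    have : F.NeBot := neBot_of_le hF
    exact asymptoticRadius_nonneg
  have := pow_le_pow_left₀ h0 hr 2
  linarith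

lemma IsAsymptoticCenter.le_of_tendsto {F : Filter ι} [F.NeBot] {c : X}
    (hc : IsAsymptoticCenter u F c) {r : ℝ} (h : Tendsto (fun n => dist (u n) c) F (𝓝 r)) :
    r ≤ asymptoticRadius u F :=
  le_of_forall_gt_imp_ge_of_dense fun s hs => _root_.le_of_tendsto h (hc s hs)

lemma asymptoticRadius_le_of_tendsto {F : Filter ι} [F.NeBot] {x : X} {r : ℝ}
    (h : Tendsto (fun n => dist (u n) x) F (𝓝 r)) : asymptoticRadius u F ≤ r :=
  le_of_forall_gt_imp_ge_of_dense fun _ hs =>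
    asymptoticRadius_le ((h.eventually_lt_const hs).mono fun _ hn => hn.le)

/-- Asymptotic centers of bounded families exist in complete spaces with midpoints satisfying the
CAT(0) inequality. -/
lemma exists_isAsymptoticCenter [CompleteSpace X]
    (hmid : ∀ x y : X, ∃ m, ∀ z,
      dist z m ^ 2 ≤ 1 / 2 * dist z x ^ 2 + 1 / 2 * dist z y ^ 2 - 1 / 4 * dist x y ^ 2)
    (hu : Bornology.IsBounded (range u)) (hX : Nonempty X) (F : Filter ι) [F.NeBot] :
    ∃ c, IsAsymptoticCenter u F c := by
  set ρ := asymptoticRadius u F with hρ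
  obtain ⟨e, hanti, he, hlim⟩ := exists_seq_strictAnti_tendsto ρ
  choose x hx using fun k => exists_eventually_dist_le hu hX (he k)
  have hb : ∀ K j k, K ≤ j → K ≤ k → dist (x j) (x k) ≤ √(4 * (e K ^ 2 - ρ ^ 2)) := by
    intro K j k hj hk
    obtain ⟨m, hm⟩ := hmid (x j) (x k)
    have : ρ ^ 2 ≤ e K ^ 2 - 1 / 4 * dist (x j) (x k) ^ 2 := by
      refine asymptoticRadius_sq_le (x := m) ?_
      filter_upwards [hx j, hx k] with n h1 h2
      have h3 := pow_le_pow_left₀ dist_nonneg (h1.trans (hanti.antitone hj)) 2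
      have h4 := pow_le_pow_left₀ dist_nonneg (h2.trans (hanti.antitone hk)) 2
      linarith [hm (u n)]
    exact Real.le_sqrt_of_sq_le (by linarith)
  have hcauchy : CauchySeq x := by
    refine cauchySeq_of_le_tendsto_0' (fun K => √(4 * (e K ^ 2 - ρ ^ 2)))
      (fun n m hnm => hb n n m le_rfl hnm) ?_
    have : Continuous fun s : ℝ => √(4 * (s ^ 2 - ρ ^ 2)) := by fun_prop
    have h := (this.tendsto ρ).comp hlim
    rwa [sub_self, mul_zero, Real.sqrt_zero] at h
  obtain ⟨c, hc⟩ := cauchySeq_tendsto_of_complete hcauchy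
  refine ⟨c, fun s hs => ?_⟩
  have h0 : Tendsto (fun k => e k + dist (x k) c) atTop (𝓝 ρ) := by
    simpa using hlim.add (tendsto_iff_dist_tendsto_zero.1 hc)
  obtain ⟨k, hk⟩ := (h0.eventually_lt_const hs).exists
  filter_upwards [hx k] with n hn
  linarith [dist_triangle (u n) (x k) c]

end AsymptoticRadius

/-- If a preorder has lower bounds of antitone sequences, every monotone real function bounded below
is constant below some point. -/
lemma exists_le_forall_le_of_monotone {P : Type*} [Preorder P] {f : P → ℝ} (hf : Monotone f)
    (hb : ∀ x, 0 ≤ f x) (hseq : ∀ x : ℕ → P, Antitone x → ∃ y, ∀ k, y ≤ x k) (x₀ : P) :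
    ∃ x ≤ x₀, ∀ y ≤ x, f x ≤ f y := by
  have step : ∀ (k : ℕ) (x : P), ∃ y ≤ x, ∀ z ≤ x, f y ≤ f z + 1 / ((k : ℝ) + 1) := by
    intro k x
    have hne : (f '' Iic x).Nonempty := ⟨f x, x, le_rfl, rfl⟩
    have hbd : BddBelow (f '' Iic x) := ⟨0, by rintro _ ⟨z, -, rfl⟩; exact hb z⟩
    obtain ⟨_, ⟨y, hy, rfl⟩, hlt⟩ := exists_lt_of_csInf_lt hne
      (lt_add_of_pos_right (sInf (f '' Iic x)) (Nat.one_div_pos_of_nat (n := k) (α := ℝ)))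
    refine ⟨y, hy, fun z hz => ?_⟩
    linarith [csInf_le hbd ⟨z, hz, rfl⟩]
  choose g hg hg' using step
  let x : ℕ → P := fun n => Nat.rec x₀ g n
  have hx : Antitone x := antitone_nat_of_succ_le fun n => hg n (x n)
  obtain ⟨y, hy⟩ := hseq x hx
  refine ⟨y, hy 0, fun z hz => ?_⟩
  have h0 : Tendsto (fun k : ℕ => f z + 1 / ((k : ℝ) + 1)) atTop (𝓝 (f z)) := by
    simpa using tendsto_const_nhds.add (tendsto_one_div_add_atTop_nhds_zero_nat (𝕜 := ℝ))
  exact ge_of_tendsto' h0 fun k => (hf (hy (k + 1))).trans (hg' k (x k) z (hz.trans (hy k)))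

/-- Below every countably generated proper filter there is one along which the asymptotic radius
does not decrease upon further refinement. -/
lemma exists_regular_filter {X ι : Type*} [MetricSpace X] {u : ι → X}
    (hu : Bornology.IsBounded (range u)) (hX : Nonempty X) (F₀ : Filter ι) [F₀.NeBot]
    [F₀.IsCountablyGenerated] :
    ∃ F ≤ F₀, F.NeBot ∧ F.IsCountablyGenerated ∧ ∀ F' ≤ F, F'.NeBot → F'.IsCountablyGenerated →
      asymptoticRadius u F ≤ asymptoticRadius u F' := by
  let P := {F : Filter ι // F.NeBot ∧ F.IsCountablyGenerated}
  obtain ⟨⟨F, h1, h2⟩, hle, hF⟩ := exists_le_forall_le_of_monotone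
    (P := P) (f := fun F => asymptoticRadius u F.1)
    (fun F' F h => have := F'.2.1; asymptoticRadius_mono hu hX h)
    (fun F => have := F.2.1; asymptoticRadius_nonneg)
    (fun x hx => ⟨⟨⨅ k, (x k).1, by
        have h := fun k => (x k).2.1
        exact iInf_neBot_of_directed' (directed_of_isDirected_le fun _ _ h => hx h) h, by
        have := fun k => (x k).2.2
        infer_instance⟩, fun k => iInf_le (fun k => (x k).1) k⟩)
    ⟨F₀, inferInstance, inferInstance⟩
  exact ⟨F, hle, h1, h2, fun F' h h3 h4 => hF ⟨F', h3, h4⟩ h⟩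

section Geodesic

variable {X : Type*} [MetricSpace X] {G : X → X → ℝ → X}

lemma dist_geodesic_left (hG0 : ∀ x y, G x y 0 = x)
    (hGd : ∀ x y, ∀ s ∈ Icc (0 : ℝ) 1, ∀ t ∈ Icc (0 : ℝ) 1,
      dist (G x y s) (G x y t) = |s - t| * dist x y)
    (x y : X) {t : ℝ} (ht : t ∈ Icc (0 : ℝ) 1) : dist x (G x y t) = t * dist x y := by
  simpa [hG0, abs_of_nonneg ht.1] using hGd x y 0 (by simp) t ht

lemma geodesic_geodesic (hG0 : ∀ x y, G x y 0 = x)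
    (hGd : ∀ x y, ∀ s ∈ Icc (0 : ℝ) 1, ∀ t ∈ Icc (0 : ℝ) 1,
      dist (G x y s) (G x y t) = |s - t| * dist x y)
    (hcmp : ∀ x y z : X, ∀ l ∈ Icc (0 : ℝ) 1,
      dist z (G x y l) ^ 2 ≤ (1 - l) * dist z x ^ 2 + l * dist z y ^ 2
        - l * (1 - l) * dist x y ^ 2)
    (x y : X) {t l : ℝ} (ht : t ∈ Icc (0 : ℝ) 1) (hl : l ∈ Icc (0 : ℝ) 1) :
    G x (G x y t) l = G x y (l * t) := by
  have hlt : l * t ∈ Icc (0 : ℝ) 1 := ⟨mul_nonneg hl.1 ht.1, mul_le_one₀ hl.2 ht.1 ht.2⟩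
  have h := hcmp x (G x y t) (G x y (l * t)) l hl
  rw [dist_comm (G x y (l * t)) x, dist_geodesic_left hG0 hGd x y hlt,
    dist_geodesic_left hG0 hGd x y ht, hGd x y _ hlt t ht, mul_pow |_|, sq_abs] at h
  have h2 : dist (G x y (l * t)) (G x (G x y t) l) ^ 2 ≤ 0 := h.trans_eq (by ring)
  exact (dist_eq_zero.1 (pow_eq_zero_iff two_ne_zero |>.1 (h2.antisymm (sq_nonneg _)))).symm

/-- If the nearest point of `v` on the segment from `c` to `y` is at distance at least `ε` from `c`,
then the point of the segment at distance `ε` from `c` is closer to `v` than `c` by a definite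
amount. -/
lemma sq_dist_le_of_nearest (hG0 : ∀ x y, G x y 0 = x)
    (hGd : ∀ x y, ∀ s ∈ Icc (0 : ℝ) 1, ∀ t ∈ Icc (0 : ℝ) 1,
      dist (G x y s) (G x y t) = |s - t| * dist x y)
    (hcmp : ∀ x y z : X, ∀ l ∈ Icc (0 : ℝ) 1,
      dist z (G x y l) ^ 2 ≤ (1 - l) * dist z x ^ 2 + l * dist z y ^ 2
        - l * (1 - l) * dist x y ^ 2)
    {c y v p : X} {ε : ℝ} (hε : 0 < ε) (hp : p ∈ G c y '' Icc (0 : ℝ) 1)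
    (hmin : ∀ q ∈ G c y '' Icc (0 : ℝ) 1, dist v p ≤ dist v q) (hd : ε ≤ dist p c) :
    dist v (G c y (ε / dist c y)) ^ 2 ≤ dist v c ^ 2 - ε ^ 2 / 2 := by
  obtain ⟨t, ht, rfl⟩ := hp
  set p := G c y t with hp
  have hcp : dist c p = t * dist c y := dist_geodesic_left hG0 hGd c y ht
  rw [dist_comm] at hd
  have hpos : 0 < dist c p := hε.trans_le hd
  have ht0 : t ≠ 0 := by
    rintro rfl
    simp [hcp] at hpos
  have hcy : dist c y ≠ 0 := by
    intro h
    simp [hcp, h] at hpos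
  have hl : ε / dist c p ∈ Icc (0 : ℝ) 1 := ⟨by positivity, div_le_one_of_le₀ hd hpos.le⟩
  have hz : G c y (ε / dist c y) = G c p (ε / dist c p) := by
    rw [hp, geodesic_geodesic hG0 hGd hcmp c y ht hl, hcp]
    congr 1
    field_simp
  have hhalf : (1 / 2 : ℝ) ∈ Icc (0 : ℝ) 1 := by norm_num
  have h1 : dist v p ^ 2 ≤ dist v (G c p (1 / 2)) ^ 2 := by
    refine pow_le_pow_left₀ dist_nonneg (hmin _ ⟨1 / 2 * t, ?_, ?_⟩) 2
    · exact ⟨by linarith [ht.1], by linarith [ht.2]⟩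
    · exact (geodesic_geodesic hG0 hGd hcmp c y ht hhalf).symm
  have h2 := hcmp c p v (1 / 2) hhalf
  have h3 := hcmp c p v (ε / dist c p) hl
  rw [hz]
  have hle : ε / dist c p * dist c p = ε := div_mul_cancel₀ _ hpos.ne'
  set l := ε / dist c p
  have h4 : dist v p ^ 2 + dist c p ^ 2 / 2 ≤ dist v c ^ 2 := by linarith
  have h5 := mul_le_mul_of_nonneg_left h4 hl.1
  have h6 : 0 ≤ l * (1 - l) * dist c p ^ 2 :=
    mul_nonneg (mul_nonneg hl.1 (by linarith [hl.2])) (sq_nonneg _)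
  rw [← hle]
  nlinarith

lemma exists_frequently_sq_dist_le_of_not_weakConv (hG0 : ∀ x y, G x y 0 = x)
    (hGd : ∀ x y, ∀ s ∈ Icc (0 : ℝ) 1, ∀ t ∈ Icc (0 : ℝ) 1,
      dist (G x y s) (G x y t) = |s - t| * dist x y)
    (hcmp : ∀ x y z : X, ∀ l ∈ Icc (0 : ℝ) 1,
      dist z (G x y l) ^ 2 ≤ (1 - l) * dist z x ^ 2 + l * dist z y ^ 2
        - l * (1 - l) * dist x y ^ 2)
    {v : ℕ → X} {c : X} (h : ¬ WeakConv G v c) :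
    ∃ z, ∃ ε > 0, ∃ᶠ n in atTop, dist (v n) z ^ 2 ≤ dist (v n) c ^ 2 - ε := by
  simp only [WeakConv, Metric.tendsto_nhds, not_forall] at h
  obtain ⟨y, p, hp, ε, hε, hfreq⟩ := h
  refine ⟨G c y (ε / dist c y), ε ^ 2 / 2, by positivity, ?_⟩
  refine (not_eventually.1 hfreq).mono fun n hn => ?_
  exact sq_dist_le_of_nearest hG0 hGd hcmp hε (hp n).1 (hp n).2 (not_lt.1 hn)

/-- Below every countably generated proper filter `F₀ ≤ atTop`, some refinement has an asymptotic
center which is a weak cluster point. -/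
lemma exists_isAsymptoticCenter_weakClusterPt [CompleteSpace X] (hG0 : ∀ x y, G x y 0 = x)
    (hGd : ∀ x y, ∀ s ∈ Icc (0 : ℝ) 1, ∀ t ∈ Icc (0 : ℝ) 1,
      dist (G x y s) (G x y t) = |s - t| * dist x y)
    (hcmp : ∀ x y z : X, ∀ l ∈ Icc (0 : ℝ) 1,
      dist z (G x y l) ^ 2 ≤ (1 - l) * dist z x ^ 2 + l * dist z y ^ 2
        - l * (1 - l) * dist x y ^ 2)
    {u : ℕ → X} (hu : Bornology.IsBounded (range u)) {F₀ : Filter ℕ} [F₀.NeBot]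
    [F₀.IsCountablyGenerated] (hF₀ : F₀ ≤ atTop) :
    ∃ F ≤ F₀, F.NeBot ∧ ∃ c, IsAsymptoticCenter u F c ∧ WeakClusterPt G u c := by
  have hX : Nonempty X := ⟨u 0⟩
  obtain ⟨F, hF, hne, hcg, hreg⟩ := exists_regular_filter hu hX F₀
  have hmid : ∀ x y : X, ∃ m, ∀ z,
      dist z m ^ 2 ≤ 1 / 2 * dist z x ^ 2 + 1 / 2 * dist z y ^ 2 - 1 / 4 * dist x y ^ 2 :=
    fun x y => ⟨G x y (1 / 2), fun z => by linarith [hcmp x y z (1 / 2) (by norm_num)]⟩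
  obtain ⟨c, hc⟩ := exists_isAsymptoticCenter hmid hu hX F
  obtain ⟨φ, hφ⟩ := exists_seq_tendsto F
  obtain ⟨ψ, hψ, hmono⟩ := strictMono_subseq_of_tendsto_atTop (hφ.mono_right (hF.trans hF₀))
  refine ⟨F, hF, hne, c, hc, φ ∘ ψ, hmono, ?_⟩
  by_contra hw
  obtain ⟨z, ε, hε, hfreq⟩ := exists_frequently_sq_dist_le_of_not_weakConv hG0 hGd hcmp hw
  have : (atTop ⊓ 𝓟 {n | dist ((u ∘ φ ∘ ψ) n) z ^ 2 ≤
      dist ((u ∘ φ ∘ ψ) n) c ^ 2 - ε}).NeBot := frequently_mem_iff_neBot.1 hfreq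
  have hle : map (φ ∘ ψ) (atTop ⊓ 𝓟 {n | dist ((u ∘ φ ∘ ψ) n) z ^ 2 ≤
      dist ((u ∘ φ ∘ ψ) n) c ^ 2 - ε}) ≤ F :=
    (map_mono inf_le_left).trans (hφ.comp hψ.tendsto_atTop)
  refine hc.not_eventually_sq_dist_le hle (hreg _ hle inferInstance inferInstance) hε (z := z) ?_
  exact eventually_map.2 (mem_inf_of_right (mem_principal_self _))

end Geodesic

/-- Let `(x_n)` be a bounded sequence in an Hadamard space `X` and
`C ⊆ X`. If for every `c ∈ C` the real sequence `(d(x_n,c))` converges, and every weak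
cluster point of `(x_n)` belongs to `C`, then `(x_n)` weakly converges to some `c ∈ C`. -/
theorem weakConv_of_distConv_and_clusterPts {X : Type*} [MetricSpace X] [CompleteSpace X]
    (G : X → X → ℝ → X)
    (hG0 : ∀ x y, G x y 0 = x) (hG1 : ∀ x y, G x y 1 = y)
    (hGd : ∀ x y, ∀ s ∈ Icc (0:ℝ) 1, ∀ t ∈ Icc (0:ℝ) 1,
      dist (G x y s) (G x y t) = |s - t| * dist x y)
    (hcmp : ∀ x y z : X, ∀ l ∈ Icc (0:ℝ) 1,
      dist z (G x y l) ^ 2 ≤ (1 - l) * dist z x ^ 2 + l * dist z y ^ 2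
        - l * (1 - l) * dist x y ^ 2)
    (u : ℕ → X) (hu : Bornology.IsBounded (Set.range u))
    (C : Set X)
    (hdist : ∀ c ∈ C, ∃ r : ℝ, Tendsto (fun n => dist (u n) c) atTop (nhds r))
    (hclu : ∀ x : X, WeakClusterPt G u x → x ∈ C) :
    ∃ c ∈ C, WeakConv G u c := by
  obtain ⟨F, hF, hne, c, hc, hcc⟩ :=
    exists_isAsymptoticCenter_weakClusterPt hG0 hGd hcmp hu (le_refl atTop)
  refine ⟨c, hclu c hcc, ?_⟩
  by_contra hw
  obtain ⟨z, ε, hε, hfreq⟩ := exists_frequently_sq_dist_le_of_not_weakConv hG0 hGd hcmp hw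
  have : (atTop ⊓ 𝓟 {n | dist (u n) z ^ 2 ≤ dist (u n) c ^ 2 - ε}).NeBot :=
    frequently_mem_iff_neBot.1 hfreq
  obtain ⟨F', hF', hne', c', hc', hcc'⟩ := exists_isAsymptoticCenter_weakClusterPt hG0 hGd hcmp hu
    (F₀ := atTop ⊓ 𝓟 {n | dist (u n) z ^ 2 ≤ dist (u n) c ^ 2 - ε}) inf_le_left
  have hF'top : F' ≤ atTop := hF'.trans inf_le_left
  obtain ⟨r, hr⟩ := hdist c (hclu c hcc)
  obtain ⟨r', hr'⟩ := hdist c' (hclu c' hcc')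
  have hrr' : r ≤ asymptoticRadius u F' := calc
    r ≤ asymptoticRadius u F := hc.le_of_tendsto (hr.mono_left hF)
    _ ≤ r' := asymptoticRadius_le_of_tendsto (hr'.mono_left hF)
    _ ≤ asymptoticRadius u F' := hc'.le_of_tendsto (hr'.mono_left hF'top)
  have hcF' : IsAsymptoticCenter u F' c := fun s hs =>
    (hr.mono_left hF'top |>.eventually_lt_const (hrr'.trans_lt hs)).mono fun _ hn => hn.le
  refine hcF'.not_eventually_sq_dist_le le_rfl le_rfl hε (z := z) ?_
  exact hF' (mem_inf_of_right (mem_principal_self _))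
end
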